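/- arXiv:2604.12953 — 2 statements merged into one kernel-verified Lean document; each statement's English description precedes it below -/
import Mathlib

section
/- Fix σ > 0 and z ∈ ℂ. The per-input conditional output entropy of the 1-bit I/Q channel is non-increasing in the input amplitude: the map s ↦ ∑_{l=0}^{3} ξ(W_σ(y_l, s·z)) is antitone on [0, ∞). -/
open MeasureTheory ProbabilityTheory

/-- Standard Gaussian tail function. -/
noncomputable def Qtail (x : ℝ) : ℝ := ((gaussianReal 0 1) (Set.Ioi x)).toReal

/-- 1-bit quantizer output points `y_l = i^l * (1 + i)`. -/
noncomputable def ypt (l : ℕ) : ℂ := Complex.I ^ l * (1 + Complex.I)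

/-- 1-bit I/Q channel law. -/
noncomputable def Wlaw (σ : ℝ) (l : ℕ) (z : ℂ) : ℝ :=
  Qtail (-(z.re * (ypt l).re) / (σ / Real.sqrt 2)) *
  Qtail (-(z.im * (ypt l).im) / (σ / Real.sqrt 2))

/-- `ξ x = -x * log₂ x` (with `ξ 0 = 0`). -/
noncomputable def xi (x : ℝ) : ℝ := -x * Real.logb 2 x

/-- Binary entropy function in bits. -/
noncomputable def Hb (p : ℝ) : ℝ := xi p + xi (1 - p)

/-- Standard circularly-symmetric complex Gaussian measure on ℂ. -/
noncomputable def muH : Measure ℂ :=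
  Measure.map (fun p : ℝ × ℝ => (p.1 : ℂ) + (p.2 : ℂ) * Complex.I)
    ((gaussianReal 0 (1/2)).prod (gaussianReal 0 (1/2)))

theorem Qtail_neg (x : ℝ) : Qtail (-x) = 1 - Qtail x := by
  have : NullSingletonClass (gaussianReal 0 1) := nullSingletonClass_gaussianReal one_ne_zero
  have h1 : (gaussianReal 0 1) (Set.Ioi (-x)) = (gaussianReal 0 1) (Set.Iic x) := by
    have h : (gaussianReal 0 1).map (fun y : ℝ => -y) = gaussianReal 0 1 := by
      rw [gaussianReal_map_neg, neg_zero]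
    conv_lhs => rw [← h]
    rw [Measure.map_apply measurable_neg measurableSet_Ioi]
    have : (fun y : ℝ => -y) ⁻¹' Set.Ioi (-x) = Set.Iio x := by
      ext y; simp
    rw [this]
    exact measure_congr Iio_ae_eq_Iic
  have h2 := probReal_compl_eq_one_sub (μ := gaussianReal 0 1) (measurableSet_Ioi (a := x))
  rw [Set.compl_Ioi] at h2
  unfold Qtail
  rw [h1]
  exact h2

theorem Qtail_anti : Antitone Qtail := fun x y h =>
  ENNReal.toReal_mono (measure_ne_top _ _) (measure_mono (Set.Ioi_subset_Ioi h))

theorem Qtail_zero : Qtail 0 = 2⁻¹ := by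
  have := Qtail_neg 0
  rw [neg_zero] at this
  linarith

theorem ent_abs (x : ℝ) : Real.binEntropy (Qtail x) = Real.binEntropy (Qtail |x|) := by
  rcases abs_choice x with h | h <;> rw [h]
  rw [Qtail_neg, Real.binEntropy_one_sub]

theorem ent_anti {x y : ℝ} (h : |x| ≤ |y|) :
    Real.binEntropy (Qtail y) ≤ Real.binEntropy (Qtail x) := by
  rw [ent_abs x, ent_abs y]
  have h0 : ∀ t : ℝ, Qtail |t| ∈ Set.Icc (0 : ℝ) 2⁻¹ := fun t =>
    ⟨ENNReal.toReal_nonneg, Qtail_zero ▸ Qtail_anti (abs_nonneg t)⟩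
  exact Real.binEntropy_strictMonoOn.monotoneOn (h0 y) (h0 x) (Qtail_anti h)

theorem xi_eq (x : ℝ) : xi x = Real.negMulLog x / Real.log 2 := by
  unfold xi Real.negMulLog Real.logb
  ring

theorem sum_eq (σ : ℝ) (z : ℂ) : ∑ l ∈ Finset.range 4, xi (Wlaw σ l z) =
    (Real.binEntropy (Qtail (z.re / (σ / Real.sqrt 2))) +
      Real.binEntropy (Qtail (z.im / (σ / Real.sqrt 2)))) / Real.log 2 := by
  have hI3 : Complex.I ^ 3 = -Complex.I := Complex.I_pow_three
  simp only [Finset.sum_range_succ, Finset.sum_range_zero, xi_eq, Wlaw, ypt, hI3, Complex.I_sq,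
    pow_zero, pow_one]
  simp [neg_div, Qtail_neg, Real.negMulLog_mul,
    Real.binEntropy_eq_negMulLog_add_negMulLog_one_sub]
  ring

theorem stmt9 (σ : ℝ) (hσ : 0 < σ) (z : ℂ) :
    AntitoneOn (fun s : ℝ => ∑ l ∈ Finset.range 4, xi (Wlaw σ l ((s : ℂ) * z)))
      (Set.Ici 0) := by
  intro s hs t ht hst
  simp only [sum_eq]
  have hs' : (0 : ℝ) ≤ s := hs
  have ht' : (0 : ℝ) ≤ t := ht
  have hl : 0 ≤ Real.log 2 := Real.log_nonneg (by norm_num)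
  refine div_le_div_of_nonneg_right (add_le_add (ent_anti ?_) (ent_anti ?_)) hl
  all_goals
    simp only [Complex.re_ofReal_mul, Complex.im_ofReal_mul, abs_div, abs_mul, abs_of_nonneg hs',
      abs_of_nonneg ht']
    gcongr
end

section
/- The map t ↦ H_b(Q(√t)) is convex on [0, ∞), where H_b is the binary entropy function and Q is the standard Gaussian tail function. -/
open MeasureTheory ProbabilityTheory

open Real Set

noncomputable def ph (x : ℝ) : ℝ := (√(2 * π))⁻¹ * exp (-(x ^ 2) / 2)

lemma ph_pos (x : ℝ) : 0 < ph x := by unfold ph; positivity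

lemma ph_eq (x : ℝ) : gaussianPDFReal 0 1 x = ph x := by
  simp [gaussianPDFReal, ph]

lemma ph_deriv (x : ℝ) : HasDerivAt ph (-x * ph x) x := by
  have h : HasDerivAt (fun x : ℝ => -(x ^ 2) / 2) (-x) x := by
    have := ((hasDerivAt_pow 2 x).neg).div_const 2
    refine HasDerivAt.congr_deriv this ?_
    simp; ring
  have := (h.exp).const_mul ((√(2 * π))⁻¹)
  refine HasDerivAt.congr_deriv this ?_
  unfold ph; ring

lemma ph_cont : Continuous ph := by
  unfold ph; fun_prop

lemma ph_int : Integrable ph := by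
  have := integrable_gaussianPDFReal 0 1
  rwa [funext ph_eq] at this

lemma Q_eq (x : ℝ) : Qtail x = ∫ y in Ioi x, ph y := by
  unfold Qtail
  rw [gaussianReal_apply_eq_integral 0 (by norm_num), ENNReal.toReal_ofReal]
  · simp [ph_eq]
  · exact integral_nonneg fun y => gaussianPDFReal_nonneg _ _ _

lemma Q_zero : Qtail 0 = 1 / 2 := by
  rw [Q_eq]
  unfold ph
  rw [integral_const_mul]
  have := integral_gaussian_Ioi (1/2)
  have h2 : (fun x : ℝ => exp (-(x ^ 2) / 2)) = fun x : ℝ => exp (-(1/2) * x ^ 2) := by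
    funext x; congr 1; ring
  rw [h2, this]
  have : π / (1/2) = 2 * π := by ring
  rw [this]
  have : √(2 * π) ≠ 0 := by positivity
  field_simp

lemma Q_eq' (x : ℝ) : Qtail x = 1 / 2 - ∫ y in (0:ℝ)..x, ph y := by
  have := intervalIntegral.integral_Ioi_sub_Ioi' (a := 0) (b := x) (μ := volume) ph_int.integrableOn ph_int.integrableOn
  rw [← Q_eq, ← Q_eq, Q_zero] at this
  linarith

lemma Q_deriv (x : ℝ) : HasDerivAt Qtail (-ph x) x := by
  rw [funext Q_eq']
  have := (ph_cont.integral_hasStrictDerivAt 0 x).hasDerivAt.const_sub (1/2)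
  exact this

lemma Q_anti : StrictAnti Qtail :=
  strictAnti_of_deriv_neg fun x => by
    rw [(Q_deriv x).deriv]; linarith [ph_pos x]

lemma Q_nonneg (x : ℝ) : 0 ≤ Qtail x := ENNReal.toReal_nonneg

lemma Q_le_one (x : ℝ) : Qtail x ≤ 1 := by
  exact measureReal_le_one

lemma Q_pos (x : ℝ) : 0 < Qtail x :=
  lt_of_le_of_lt (Q_nonneg (x+1)) (Q_anti (by linarith))

lemma Q_lt_one (x : ℝ) : 0 < 1 - Qtail x := by
  have := lt_of_lt_of_le (Q_anti (show x - 1 < x by linarith)) (Q_le_one (x-1))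
  linarith

lemma Q_le_half {x : ℝ} (hx : 0 ≤ x) : Qtail x ≤ 1 / 2 := by
  rw [← Q_zero]; exact Q_anti.antitone hx

lemma c_bound : (√(2 * π))⁻¹ ≤ 0.4 ∧ 0.39 ≤ (√(2 * π))⁻¹ := by
  have h1 : 2.5 ≤ √(2 * π) := by
    apply Real.le_sqrt_of_sq_le; nlinarith [Real.pi_gt_d2]
  have h2 : √(2 * π) ≤ 2.51 := by
    rw [Real.sqrt_le_left (by norm_num)]; nlinarith [Real.pi_lt_d4]
  constructor
  · rw [inv_le_comm₀ (by linarith) (by norm_num)]; norm_num at *; linarith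
  · rw [le_inv_comm₀ (by norm_num) (by linarith)]; norm_num at *; linarith

lemma ph_le (x : ℝ) : ph x ≤ 0.4 := by
  have := c_bound.1
  have h : exp (-(x ^ 2) / 2) ≤ 1 := by
    rw [Real.exp_le_one_iff]; nlinarith [sq_nonneg x]
  unfold ph
  have h3 : 0 < (√(2 * π))⁻¹ := by positivity
  nlinarith [exp_pos (-(x ^ 2) / 2)]

/-- Mills ratio lower bound. -/
lemma mills {x : ℝ} (hx : 0 ≤ x) : x * ph x ≤ (1 + x ^ 2) * Qtail x := by
  have hd : ∀ y, HasDerivAt (fun y => Qtail y - y * ph y / (1 + y ^ 2))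
      (-(2 * ph y / (1 + y ^ 2) ^ 2)) y := by
    intro y
    have hp : (1 + y ^ 2) ≠ 0 := by positivity
    have := (Q_deriv y).sub ((((hasDerivAt_id y).mul (ph_deriv y))).div
      ((hasDerivAt_pow 2 y).const_add 1) hp)
    refine HasDerivAt.congr_deriv this ?_
    simp
    field_simp
    ring
  have ha : Antitone (fun y => Qtail y - y * ph y / (1 + y ^ 2)) :=
    antitone_of_hasDerivAt_nonpos hd fun y => by
      have := ph_pos y
      simp only [Pi.zero_apply, neg_nonpos]; positivity
  have key : 0 ≤ Qtail x - x * ph x / (1 + x ^ 2) := by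
    by_contra hneg
    push Not at hneg
    set e := -(Qtail x - x * ph x / (1 + x ^ 2)) with he
    have hepos : 0 < e := by linarith
    set y := x + 1 / e with hy
    have hyx : x ≤ y := by rw [hy]; have : 0 < 1 / e := by positivity
                           linarith
    have hy0 : 0 < y := by have : 0 < 1 / e := by positivity
                           linarith
    have h1 := ha hyx
    simp only at h1
    have h2 : y * ph y / (1 + y ^ 2) < e := by
      rw [div_lt_iff₀ (by positivity)]
      have h3 : 1 ≤ e * y := by
        rw [hy, mul_add, mul_one_div_cancel hepos.ne']
        nlinarith
      have h4 := ph_le y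
      nlinarith [mul_le_mul_of_nonneg_left h4 hy0.le]
    linarith [Q_nonneg y]
  rw [sub_nonneg, div_le_iff₀ (by positivity)] at key
  linarith

lemma Q_ge {x : ℝ} (hx : 0 ≤ x) : 1 / 2 - (√(2 * π))⁻¹ * x ≤ Qtail x := by
  have hd : ∀ y, HasDerivAt (fun y => Qtail y + (√(2 * π))⁻¹ * y)
      (-ph y + (√(2 * π))⁻¹) y := by
    intro y
    have := (Q_deriv y).add ((hasDerivAt_id y).const_mul ((√(2 * π))⁻¹))
    exact HasDerivAt.congr_deriv this (by simp)
  have ha : Monotone (fun y => Qtail y + (√(2 * π))⁻¹ * y) :=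
    monotone_of_hasDerivAt_nonneg hd fun y => by
      have h : exp (-(y ^ 2) / 2) ≤ 1 := by
        rw [Real.exp_le_one_iff]; nlinarith [sq_nonneg y]
      have h3 : 0 < (√(2 * π))⁻¹ := by positivity
      simp only [Pi.zero_apply, ph]; nlinarith
  have := ha hx
  simp only [Q_zero] at this
  linarith

lemma keyK {x : ℝ} (hx : 0 ≤ x) :
    ph x * (1 - 2 * Qtail x) ≤ 2 * x * (Qtail x * (1 - Qtail x)) := by
  have hm := mills hx
  have hp := ph_pos x
  have hq := Q_pos x
  have hq1 := Q_lt_one x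
  rcases le_total 1 x with h1 | h1
  · have : ph x ≤ 2 * x * Qtail x := by
      have : x * ph x ≤ x * (2 * x * Qtail x) := by
        have h9 : 0 ≤ (x ^ 2 - 1) * Qtail x := mul_nonneg (by nlinarith) hq.le
        nlinarith
      exact le_of_mul_le_mul_left this (by linarith)
    nlinarith [mul_pos hp hq]
  rcases le_total 0.9 x with h2 | h2
  · have hph : 0.22 ≤ ph x := by
      have h3 : 0.6 ≤ exp (-(x ^ 2) / 2) := by
        have : exp (-(1/2)) ≤ exp (-(x ^ 2) / 2) := by
          apply Real.exp_le_exp.2; nlinarith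
        have h5 : (0.6:ℝ) ≤ exp (-(1/2)) := by
          have e1 := Real.exp_one_lt_d9
          have e2 : exp (1/2) ^ 2 = exp 1 := by rw [← Real.exp_nat_mul]; norm_num
          have e3 : exp (1/2) ≤ 1.66 := by
            apply le_of_not_gt; intro hlt; have e4 : (1.66:ℝ) ^ 2 < exp (1/2) ^ 2 := by gcongr
            rw [e2] at e4; norm_num at e1 e4; linarith
          rw [Real.exp_neg, le_inv_comm₀ (by norm_num) (by positivity)]
          norm_num at *; linarith
        linarith
      unfold ph
      nlinarith [c_bound.2]
    -- x φ ≤ (1+x²) Q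
    have a1 : x * ph x * (1 - Qtail x) ≤ (1 + x ^ 2) * Qtail x * (1 - Qtail x) :=
      mul_le_mul_of_nonneg_right hm hq1.le
    have a2 : 0.22 * (Qtail x * (1 - Qtail x)) ≤ ph x * Qtail x := by
      nlinarith [mul_pos hq hq, mul_pos hq hq1]
    have a3 : x * (0.22 * (Qtail x * (1 - Qtail x))) ≤ x * (ph x * Qtail x) :=
      mul_le_mul_of_nonneg_left a2 hx
    have a4 : 0 ≤ (x ^ 2 + 0.22 * x - 1) * (Qtail x * (1 - Qtail x)) := by
      apply mul_nonneg _ (mul_pos hq hq1).le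
      nlinarith
    have : x * (ph x * (1 - 2 * Qtail x)) ≤ x * (2 * x * (Qtail x * (1 - Qtail x))) := by
      nlinarith
    exact le_of_mul_le_mul_left this (by linarith)
  · set c := (√(2 * π))⁻¹ with hc
    have hc0 : 0 < c := by positivity
    have hc2 : c ≤ 0.4 := c_bound.1
    have hQ := Q_ge hx
    rw [← hc] at hQ
    have hQh := Q_le_half hx
    set m := 1 - 2 * Qtail x with hmdef
    have hm0 : 0 ≤ m := by linarith
    have hm1 : m ≤ 2 * c * x := by linarith
    have hQQ : Qtail x * (1 - Qtail x) = (1 - m ^ 2) / 4 := by rw [hmdef]; ring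
    rw [hQQ]
    have hph : ph x * (1 + x ^ 2 / 2) ≤ c := by
      have : exp (-(x ^ 2) / 2) * (1 + x ^ 2 / 2) ≤ 1 := by
        have h5 := Real.add_one_le_exp (x ^ 2 / 2)
        have h6 : exp (-(x ^ 2) / 2) * exp (x ^ 2 / 2) = 1 := by
          rw [← Real.exp_add]; simp [neg_div]
        rw [← h6]
        apply mul_le_mul_of_nonneg_left _ (exp_pos _).le
        linarith
      unfold ph
      rw [← hc, mul_assoc]
      nlinarith
    have hcs : c ^ 2 ≤ 0.16 := by nlinarith
    -- reduce
    have b1 : ph x * m ≤ ph x * (2 * c * x) := mul_le_mul_of_nonneg_left hm1 hp.le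
    have b2 : m ^ 2 ≤ (2 * c * x) ^ 2 := by gcongr
    have b3 : m ^ 2 ≤ 0.64 * x ^ 2 := by nlinarith [sq_nonneg x]
    have b4 : ph x * c * (1 + x ^ 2 / 2) ≤ 0.16 := by nlinarith
    have b5 : 4 * (ph x * c) ≤ 1 - 0.64 * x ^ 2 := by
      have hs : x ^ 2 ≤ 0.81 := by nlinarith
      have : 4 * (ph x * c) * (1 + x ^ 2 / 2) ≤ (1 - 0.64 * x ^ 2) * (1 + x ^ 2 / 2) := by
        nlinarith [sq_nonneg x]
      exact le_of_mul_le_mul_right this (by positivity)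
    nlinarith [mul_le_mul_of_nonneg_left (b5.trans (by linarith : 1 - 0.64 * x ^ 2 ≤ 1 - m ^ 2)) hx]

noncomputable def Lr (x : ℝ) : ℝ := log (1 - Qtail x) - log (Qtail x)

noncomputable def Ld (x : ℝ) : ℝ := ph x / (Qtail x * (1 - Qtail x))

lemma L_deriv (x : ℝ) : HasDerivAt Lr (Ld x) x := by
  have h1 := (Q_pos x).ne'
  have h2 := (Q_lt_one x).ne'
  have := (((Q_deriv x).const_sub 1).log h2).sub ((Q_deriv x).log h1)
  refine HasDerivAt.congr_deriv this ?_
  unfold Ld; field_simp; ring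

lemma L_nonneg {x : ℝ} (hx : 0 ≤ x) : 0 ≤ Lr x := by
  unfold Lr
  have := Q_le_half hx
  rw [sub_nonneg]
  exact Real.log_le_log (Q_pos x) (by linarith)

lemma Ld_deriv (x : ℝ) : HasDerivAt Ld
    (Ld x * (ph x * (1 - 2 * Qtail x) / (Qtail x * (1 - Qtail x)) - x)) x := by
  have h1 := (Q_pos x).ne'
  have h2 := (Q_lt_one x).ne'
  have := (ph_deriv x).div ((Q_deriv x).mul ((Q_deriv x).const_sub 1)) (mul_ne_zero h1 h2)
  refine HasDerivAt.congr_deriv this ?_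
  unfold Ld; simp only [Pi.mul_apply]; field_simp; ring

lemma D_nonneg {x : ℝ} (hx : 0 ≤ x) : 0 ≤ (1 + x ^ 2) * Lr x - x * Ld x := by
  have hd : ∀ y, HasDerivAt (fun y => (1 + y ^ 2) * Lr y - y * Ld y)
      (y * (2 * Lr y + Ld y * (2 * y - ph y * (1 - 2 * Qtail y) / (Qtail y * (1 - Qtail y))))) y := by
    intro y
    have := (((hasDerivAt_pow 2 y).const_add 1).mul (L_deriv y)).sub
      ((hasDerivAt_id y).mul (Ld_deriv y))
    refine HasDerivAt.congr_deriv this ?_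
    simp; ring
  have hm : MonotoneOn (fun y => (1 + y ^ 2) * Lr y - y * Ld y) (Ici 0) := by
    apply monotoneOn_of_deriv_nonneg (convex_Ici 0)
    · exact fun y _ => (hd y).continuousAt.continuousWithinAt
    · exact fun y _ => (hd y).differentiableAt.differentiableWithinAt
    · intro y hy
      rw [interior_Ici] at hy
      have hy : 0 ≤ y := le_of_lt hy
      rw [(hd y).deriv]
      have hQ := mul_pos (Q_pos y) (Q_lt_one y)
      have h1 : 0 ≤ Ld y := div_nonneg (ph_pos y).le hQ.le
      have h2 : ph y * (1 - 2 * Qtail y) / (Qtail y * (1 - Qtail y)) ≤ 2 * y := by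
        rw [div_le_iff₀ hQ]; exact keyK hy
      have h3 := L_nonneg hy
      have h4 := mul_nonneg h1 (sub_nonneg.2 h2)
      exact mul_nonneg hy (by linarith)
  have := hm (mem_Ici.2 le_rfl) (mem_Ici.2 hx) hx
  simp only at this
  have h0 : Lr 0 = 0 := by unfold Lr; rw [Q_zero]; norm_num
  rw [h0] at this
  simpa using this

lemma g_anti : AntitoneOn (fun x => ph x * Lr x / x) (Ioi 0) := by
  have hd : ∀ y : ℝ, 0 < y → HasDerivAt (fun x => ph x * Lr x / x)
      (-(ph y / y ^ 2 * ((1 + y ^ 2) * Lr y - y * Ld y))) y := by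
    intro y hy
    have := ((ph_deriv y).mul (L_deriv y)).div (hasDerivAt_id y) hy.ne'
    refine HasDerivAt.congr_deriv this ?_
    simp; field_simp; ring
  apply antitoneOn_of_deriv_nonpos (convex_Ioi 0)
  · exact fun y hy => (hd y hy).continuousAt.continuousWithinAt
  · rw [interior_Ioi]
    exact fun y hy => (hd y hy).differentiableAt.differentiableWithinAt
  · rw [interior_Ioi]
    intro y hy
    rw [(hd y hy).deriv, neg_nonpos]
    exact mul_nonneg (div_nonneg (ph_pos y).le (sq_nonneg y)) (D_nonneg (le_of_lt hy))

lemma V_deriv (x : ℝ) : HasDerivAt (fun x => Hb (Qtail x)) (-(ph x * Lr x) / log 2) x := by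
  have h1 := (Q_pos x).ne'
  have h2 := (Q_lt_one x).ne'
  have a := (Q_deriv x)
  have b := a.const_sub 1
  have := ((a.neg.mul ((a.log h1).div_const (log 2))).add
    (b.neg.mul ((b.log h2).div_const (log 2))))
  have hl : log 2 ≠ 0 := (Real.log_pos (by norm_num)).ne'
  refine HasDerivAt.congr_deriv this ?_
  unfold Lr; simp; field_simp; ring

theorem stmt13 : ConvexOn ℝ (Set.Ici 0) (fun t : ℝ => Hb (Qtail (Real.sqrt t))) := by
  have hd : ∀ t : ℝ, 0 < t → HasDerivAt (fun t : ℝ => Hb (Qtail (√t)))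
      (-(ph (√t) * Lr (√t) / √t) * (1 / (2 * log 2))) t := by
    intro t ht
    have := (V_deriv (√t)).comp t (Real.hasDerivAt_sqrt ht.ne')
    have hs : √t ≠ 0 := (Real.sqrt_pos.2 ht).ne'
    have hl : log 2 ≠ 0 := (Real.log_pos (by norm_num)).ne'
    refine HasDerivAt.congr_deriv this ?_
    field_simp
  have hl : 0 < log 2 := Real.log_pos (by norm_num)
  apply MonotoneOn.convexOn_of_deriv (convex_Ici 0)
  · have hc : Continuous (fun x => Hb (Qtail x)) :=
      continuous_iff_continuousAt.2 fun x => (V_deriv x).continuousAt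
    exact (hc.comp Real.continuous_sqrt).continuousOn
  · rw [interior_Ici]
    exact fun t ht => (hd t ht).differentiableAt.differentiableWithinAt
  · rw [interior_Ici]
    intro s hs t ht hst
    rw [(hd s hs).deriv, (hd t ht).deriv]
    apply mul_le_mul_of_nonneg_right _ (by positivity)
    apply neg_le_neg
    exact g_anti (Real.sqrt_pos.2 hs) (Real.sqrt_pos.2 ht) (Real.sqrt_le_sqrt hst)
end
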